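/- There is exactly one maximal flag in F^n whose label is the identity permutation, namely the standard flag whose j-th subspace is the span of the first j standard basis vectors e_1,…,e_j of F^n. -/

import Mathlib

open Matrix

variable {n : ℕ} {F : Type} [Field F]

/-- `(r, j)` is a pivot position of `M`: the entry `M r j` is nonzero and all entries of
column `j` strictly below row `r` vanish (i.e. `r` is the largest row index with `M r j ≠ 0`). -/
def IsPivot (M : Matrix (Fin n) (Fin n) F) (r j : Fin n) : Prop :=
  M r j ≠ 0 ∧ ∀ r' : Fin n, r < r' → M r' j = 0

/-- The span of the first `j` columns of `M` (columns with index `< j` in 0-based indexing). -/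
def colSpan (M : Matrix (Fin n) (Fin n) F) (j : ℕ) : Submodule F (Fin n → F) :=
  Submodule.span F ((fun i : Fin n => Mᵀ i) '' {i : Fin n | (i : ℕ) < j})

/-- A flag: a nonempty finite set of proper nonzero subspaces of `F^n` forming a chain. -/
def IsFlag (g : Set (Submodule F (Fin n → F))) : Prop :=
  g.Finite ∧ g.Nonempty ∧ IsChain (· ≤ ·) g ∧ ∀ V ∈ g, V ≠ ⊥ ∧ V ≠ ⊤

/-- A maximal flag: a flag containing a subspace of every dimension `1,…,n-1`. -/
def IsMaximalFlag (f : Set (Submodule F (Fin n → F))) : Prop :=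
  IsFlag f ∧ ∀ j : ℕ, 1 ≤ j → j ≤ n - 1 → ∃ V ∈ f, Module.finrank F V = j

/-- Conditions (i)–(iii) for a matrix representation of a flag `f`:
(i) for every `V ∈ f` the first `dim V` columns of `M` span `V`, and all `n` columns span `F^n`;
(ii) every pivot entry equals `1`;
(iii) entries in the same row as a pivot and strictly to its right vanish. -/
def IsRep (f : Set (Submodule F (Fin n → F))) (M : Matrix (Fin n) (Fin n) F) : Prop :=
  (∀ V ∈ f, colSpan M (Module.finrank F V) = V) ∧
  colSpan M n = ⊤ ∧
  (∀ r j : Fin n, IsPivot M r j → M r j = 1) ∧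
  (∀ r j j' : Fin n, IsPivot M r j → j < j' → M r j' = 0)

/-- Columns `i` and `i'` lie in the same block of the block decomposition induced by the
flag `g` (blocks are the intervals of columns between consecutive dimensions of members of `g`). -/
def SameBlock (g : Set (Submodule F (Fin n → F))) (i i' : Fin n) : Prop :=
  ∀ V ∈ g, ((i : ℕ) < Module.finrank F V ↔ (i' : ℕ) < Module.finrank F V)

/-- The minimal matrix representation of a flag `g`: conditions (i)–(iii) together with
(iv) within each block, entries in the same row as a pivot of the block and strictly to its left
within the block vanish; (v) within each block, pivot row indices strictly increase. -/
def IsMinRep (g : Set (Submodule F (Fin n → F))) (M : Matrix (Fin n) (Fin n) F) : Prop :=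
  IsRep g M ∧
  (∀ r i i' : Fin n, SameBlock g i i' → IsPivot M r i → i' < i → M r i' = 0) ∧
  (∀ r r' i i' : Fin n, SameBlock g i i' → IsPivot M r i → IsPivot M r' i' → i < i' → r < r')

/-- `σ` is the label of the maximal flag `f`: `σ j` is the pivot row of the `j`-th column of
the minimal matrix representation of `f`. -/
def IsLabel (f : Set (Submodule F (Fin n → F))) (σ : Equiv.Perm (Fin n)) : Prop :=
  ∃ M : Matrix (Fin n) (Fin n) F, IsRep f M ∧ ∀ j : Fin n, IsPivot M (σ j) j

/-- Strict lexicographic order on permutations in one-line notation `(σ 0, …, σ (n-1))`. -/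
def LexLt {n : ℕ} (σ τ : Equiv.Perm (Fin n)) : Prop :=
  ∃ j : Fin n, (∀ i : Fin n, i < j → σ i = τ i) ∧ σ j < τ j

/-- `σ` is the lexicographically least label among the labels of maximal flags containing `g`. -/
def IsMinlabel (g : Set (Submodule F (Fin n → F))) (σ : Equiv.Perm (Fin n)) : Prop :=
  (∃ f, IsMaximalFlag f ∧ g ⊆ f ∧ IsLabel f σ) ∧
  ∀ (f : Set (Submodule F (Fin n → F))) (τ : Equiv.Perm (Fin n)),
    IsMaximalFlag f → g ⊆ f → IsLabel f τ → σ = τ ∨ LexLt σ τ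

/-- `t` is a (0-based) ascent of `σ`: `σ t < σ (t+1)`.  (In the 1-based indexing of the paper
this corresponds to the ascent `(σ(t+1), σ(t+2))` at position `t+1`.) -/
def Ascent {n : ℕ} (σ : Equiv.Perm (Fin n)) (t : ℕ) : Prop :=
  ∃ h : t + 1 < n, σ ⟨t, Nat.lt_of_succ_lt h⟩ < σ ⟨t + 1, h⟩

/-- `σ` is the decreasing permutation `σ(j) = n + 1 - j` (in 0-based indexing, `n - 1 - j`). -/
def IsDecreasing {n : ℕ} (σ : Equiv.Perm (Fin n)) : Prop :=
  ∀ j : Fin n, (σ j : ℕ) = n - 1 - (j : ℕ)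

theorem finrank_span_single_lt {j : ℕ} (hj : j ≤ n) :
    Module.finrank F (Submodule.span F
      ((fun i : Fin n => (Pi.single i (1 : F) : Fin n → F)) '' {i : Fin n | (i : ℕ) < j})) = j := by
  have hli : LinearIndependent F
      (fun i : Fin n => (Pi.single i (1 : F) : Fin n → F)) :=
    Pi.linearIndependent_single_one (Fin n) F
  rw [← Fin.range_castLE hj, ← Set.range_comp,
    finrank_span_eq_card (hli.comp _ (Fin.castLE_injective hj)), Fintype.card_fin]

theorem colSpan_one (j : ℕ) :
    colSpan (1 : Matrix (Fin n) (Fin n) F) j = Submodule.span F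
      ((fun i : Fin n => (Pi.single i (1 : F) : Fin n → F)) '' {i : Fin n | (i : ℕ) < j}) := by
  unfold colSpan
  congr 2
  funext i
  rw [transpose_one]
  exact funext fun k => by simp [Matrix.one_apply, Pi.single_apply, eq_comm]

theorem finrank_colSpan_one {j : ℕ} (hj : j ≤ n) :
    Module.finrank F (colSpan (1 : Matrix (Fin n) (Fin n) F) j) = j := by
  rw [colSpan_one, finrank_span_single_lt hj]

theorem colSpan_mono (M : Matrix (Fin n) (Fin n) F) : Monotone (colSpan M) := fun _ _ h =>
  Submodule.span_mono (Set.image_mono fun _ hi => lt_of_lt_of_le hi h)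

theorem isPivot_one (j : Fin n) : IsPivot (1 : Matrix (Fin n) (Fin n) F) j j :=
  ⟨by simp, fun _ h => Matrix.one_apply_ne h.ne'⟩

theorem IsPivot.eq_of_one {r j : Fin n} (h : IsPivot (1 : Matrix (Fin n) (Fin n) F) r j) :
    r = j := by
  by_contra hne
  exact h.1 (Matrix.one_apply_ne hne)

theorem IsRep.eq_one {f : Set (Submodule F (Fin n → F))} {M : Matrix (Fin n) (Fin n) F}
    (hM : IsRep f M) (hp : ∀ j, IsPivot M j j) : M = 1 := by
  ext r j
  rcases lt_trichotomy r j with h | rfl | h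
  · rw [Matrix.one_apply_ne h.ne, hM.2.2.2 r r j (hp r) h]
  · rw [Matrix.one_apply_eq, hM.2.2.1 r r (hp r)]
  · rw [Matrix.one_apply_ne h.ne', (hp j).2 r h]

theorem IsMaximalFlag.eq_image_colSpan_one {f : Set (Submodule F (Fin n → F))}
    (hf : IsMaximalFlag f) (hl : IsLabel f 1) :
    f = colSpan (1 : Matrix (Fin n) (Fin n) F) '' Set.Icc 1 (n - 1) := by
  obtain ⟨M, hM, hp⟩ := hl
  obtain rfl := hM.eq_one hp
  ext V
  constructor
  · intro hV
    obtain ⟨hbot, htop⟩ := hf.1.2.2.2 V hV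
    have h1 : 1 ≤ Module.finrank F V := Submodule.one_le_finrank_iff.mpr hbot
    have h2 := Submodule.finrank_lt htop
    rw [Module.finrank_fin_fun] at h2
    exact ⟨_, ⟨h1, by omega⟩, hM.1 V hV⟩
  · rintro ⟨j, ⟨h1, h2⟩, rfl⟩
    obtain ⟨V, hV, rfl⟩ := hf.2 j h1 h2
    rwa [hM.1 V hV]

theorem isMaximalFlag_image_colSpan_one (hn : 2 ≤ n) :
    IsMaximalFlag (colSpan (1 : Matrix (Fin n) (Fin n) F) '' Set.Icc 1 (n - 1)) := by
  refine ⟨⟨(Set.finite_Icc _ _).image _, ⟨_, 1, ⟨le_rfl, by omega⟩, rfl⟩, ?_, ?_⟩, ?_⟩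
  · rintro _ ⟨a, _, rfl⟩ _ ⟨b, _, rfl⟩ _
    exact (le_total a b).imp (fun h => colSpan_mono _ h) (fun h => colSpan_mono _ h)
  · rintro _ ⟨j, ⟨h1, h2⟩, rfl⟩
    have hj := finrank_colSpan_one (F := F) (show j ≤ n by omega)
    constructor
    · intro h
      rw [h, finrank_bot] at hj
      omega
    · intro h
      rw [h, finrank_top, Module.finrank_fin_fun] at hj
      omega
  · exact fun j h1 h2 => ⟨_, ⟨j, ⟨h1, h2⟩, rfl⟩, finrank_colSpan_one (by omega)⟩

theorem isLabel_image_colSpan_one :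
    IsLabel (colSpan (1 : Matrix (Fin n) (Fin n) F) '' Set.Icc 1 (n - 1)) 1 := by
  refine ⟨1, ⟨?_, ?_, ?_, ?_⟩, isPivot_one⟩
  · rintro _ ⟨j, ⟨_, h2⟩, rfl⟩
    rw [finrank_colSpan_one (by omega)]
  · apply Submodule.eq_top_of_finrank_eq
    rw [finrank_colSpan_one le_rfl, Module.finrank_fin_fun]
  · intro r j h
    rw [h.eq_of_one, Matrix.one_apply_eq]
  · intro r j j' h hlt
    rw [h.eq_of_one, Matrix.one_apply_ne hlt.ne]

/-- there is exactly one maximal flag whose label is the identity permutation,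
namely the standard flag whose `j`-th subspace is the span of `e_1, …, e_j`. -/
theorem unique_maximal_flag_with_identity_label
    [Fintype F] (hn : 2 ≤ n) :
    {f : Set (Submodule F (Fin n → F)) | IsMaximalFlag f ∧ IsLabel f 1} =
      {(fun j : ℕ => Submodule.span F
          ((fun i : Fin n => Pi.single i (1 : F)) '' {i : Fin n | (i : ℕ) < j})) ''
        Set.Icc 1 (n - 1)} := by
  have hstd := funext (colSpan_one (n := n) (F := F))
  rw [← hstd]
  ext f
  constructor
  · rintro ⟨hf, hl⟩
    exact hf.eq_image_colSpan_one hl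
  · rintro rfl
    exact ⟨isMaximalFlag_image_colSpan_one hn, isLabel_image_colSpan_one⟩
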